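/- Let A, B, E ⊆ ℝ be Lebesgue measurable sets with finite, positive measures, let D = D(A,B,E) be the Riesz–Sobolev deficit, and suppose ||A|−|B|| + 2D^{1/2} < |E| < |A| + |B| − 2D^{1/2}. Define τ_E by |E| = |A| + |B| − 2τ_E. Then ⟨1_A∗1_B, 1_E⟩ + (1/16)·( |S_{A,B}(τ_E)| − (|A| + |B| − 2τ_E) )² ≤ ⟨1_{A⋆}∗1_{B⋆}, 1_{E⋆}⟩. -/

import Mathlib

open MeasureTheory Set Pointwise

/-- Lebesgue measure of a set of reals, as a real number. -/
noncomputable def lm (S : Set ℝ) : ℝ := (MeasureTheory.volume S).toReal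

/-- Convolution of indicator functions: `(1_A ∗ 1_B)(x) = ∫ 1_A(y) 1_B(x−y) dy`. -/
noncomputable def cv (A B : Set ℝ) (x : ℝ) : ℝ :=
  ∫ y, A.indicator (1 : ℝ → ℝ) y * B.indicator (1 : ℝ → ℝ) (x - y)

/-- The pairing `⟨1_A ∗ 1_B, 1_C⟩ = ∫ (1_A ∗ 1_B) · 1_C`. -/
noncomputable def pr (A B C : Set ℝ) : ℝ := ∫ x, cv A B x * C.indicator (1 : ℝ → ℝ) x

/-- The symmetric rearrangement `S⋆`: the open interval centered at 0 with `|S⋆| = |S|`. -/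
noncomputable def sstar (S : Set ℝ) : Set ℝ := Set.Ioo (-(lm S / 2)) (lm S / 2)

/-- The Riesz–Sobolev deficit `D(A,B,C) = ⟨1_{A⋆}∗1_{B⋆},1_{C⋆}⟩ − ⟨1_A∗1_B,1_C⟩`. -/
noncomputable def rsD (A B C : Set ℝ) : ℝ := pr (sstar A) (sstar B) (sstar C) - pr A B C

/-- The superlevel set `S_{A,B}(t) = {x : (1_A ∗ 1_B)(x) > t}`. -/
def slev (A B : Set ℝ) (t : ℝ) : Set ℝ := {x | cv A B x > t}

/-- The KPRGT deficit `D′(A,B,τ) = (|A|−τ)(|B|−τ) − ∫_τ^∞ |S_{A,B}(t)| dt`. -/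
noncomputable def kD (A B : Set ℝ) (τ : ℝ) : ℝ :=
  (lm A - τ) * (lm B - τ) - ∫ t in Set.Ioi τ, lm (slev A B t)

/-- `η`-strict admissibility of the ordered triple `(A,B,C)`:
`|X| + |Y| ≥ |Z| + η·max(|A|,|B|,|C|)` for every permutation `(X,Y,Z)` of `(A,B,C)`. -/
def adm (η : ℝ) (A B C : Set ℝ) : Prop :=
  lm A + lm B ≥ lm C + η * max (lm A) (max (lm B) (lm C)) ∧
  lm A + lm C ≥ lm B + η * max (lm A) (max (lm B) (lm C)) ∧
  lm B + lm C ≥ lm A + η * max (lm A) (max (lm B) (lm C))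

theorem lm_nonneg (S : Set ℝ) : 0 ≤ lm S := ENNReal.toReal_nonneg

theorem lm_inter_Iic_add_lm_inter_Ioi {A : Set ℝ} (hA : volume A ≠ ⊤) (α : ℝ) :
    lm (A ∩ Iic α) + lm (A ∩ Ioi α) = lm A := by
  have h := measureReal_inter_add_sdiff (μ := volume) (s := A) (t := Iic α) measurableSet_Iic hA
  rwa [sdiff_eq, compl_Iic] at h

theorem lm_mono {S T : Set ℝ} (h : S ⊆ T) (hT : volume T ≠ ⊤) : lm S ≤ lm T :=
  measureReal_mono h hT

theorem lm_le_lm_add_lm {S T U : Set ℝ} (h : S ⊆ T ∪ U) (hT : volume T ≠ ⊤)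
    (hU : volume U ≠ ⊤) : lm S ≤ lm T + lm U :=
  (measureReal_mono h (measure_union_ne_top hT hU)).trans (measureReal_union_le _ _)

theorem integrable_indicator_one {S : Set ℝ} (hS : MeasurableSet S) (hf : volume S ≠ ⊤) :
    Integrable (S.indicator (1 : ℝ → ℝ)) :=
  (integrable_indicator_iff hS).2 (integrableOn_const hf)

theorem integral_indicator_one_eq_lm {S : Set ℝ} (hS : MeasurableSet S) :
    ∫ x, S.indicator (1 : ℝ → ℝ) x = lm S :=
  integral_indicator_one hS

theorem cv_eq_lm {A B : Set ℝ} (hA : MeasurableSet A) (hB : MeasurableSet B) (x : ℝ) :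
    cv A B x = lm (A ∩ (fun y => x - y) ⁻¹' B) := by
  rw [← integral_indicator_one_eq_lm (hA.inter (measurable_const_sub x hB)), cv]
  congr 1 with y
  by_cases h1 : y ∈ A <;> by_cases h2 : x - y ∈ B <;> simp [indicator, h1, h2]

theorem cv_nonneg (A B : Set ℝ) (x : ℝ) : 0 ≤ cv A B x :=
  integral_nonneg fun y => mul_nonneg (indicator_nonneg (fun _ _ => zero_le_one) y)
    (indicator_nonneg (fun _ _ => zero_le_one) _)

theorem cv_eq_convolution (A B : Set ℝ) :
    cv A B = convolution (A.indicator (1 : ℝ → ℝ)) (B.indicator (1 : ℝ → ℝ))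
      (ContinuousLinearMap.mul ℝ ℝ) volume := rfl

theorem integrable_cv {A B : Set ℝ} (hA : MeasurableSet A) (hB : MeasurableSet B)
    (hAf : volume A ≠ ⊤) (hBf : volume B ≠ ⊤) : Integrable (cv A B) := by
  rw [cv_eq_convolution]
  exact (integrable_indicator_one hA hAf).integrable_convolution _
    (integrable_indicator_one hB hBf)

theorem integral_cv {A B : Set ℝ} (hA : MeasurableSet A) (hB : MeasurableSet B)
    (hAf : volume A ≠ ⊤) (hBf : volume B ≠ ⊤) : ∫ x, cv A B x = lm A * lm B := by
  rw [cv_eq_convolution, integral_convolution _ (integrable_indicator_one hA hAf)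
    (integrable_indicator_one hB hBf), integral_indicator_one_eq_lm hA,
    integral_indicator_one_eq_lm hB]
  rfl

theorem exists_lm_inter_Iic_eq {A : Set ℝ} (hAf : volume A ≠ ⊤)
    {σ : ℝ} (h0 : 0 < σ) (h1 : σ < lm A) : ∃ α, lm (A ∩ Iic α) = σ := by
  have : IsFiniteMeasure (volume.restrict A) := ⟨by simpa using hAf.lt_top⟩
  have hr (α : ℝ) : (volume.restrict A (Iic α)).toReal = lm (A ∩ Iic α) := by
    rw [Measure.restrict_apply measurableSet_Iic, inter_comm, lm]
  have hcont : Continuous fun α => lm (A ∩ Iic α) := by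
    have hlip (α β : ℝ) (h : α ≤ β) : lm (A ∩ Iic β) ≤ lm (A ∩ Iic α) + (β - α) := by
      have h2 := lm_le_lm_add_lm (S := A ∩ Iic β) (T := A ∩ Iic α) (U := Ioc α β)
        (fun x hx => (le_or_gt x α).imp (fun h => ⟨hx.1, h⟩) fun h => ⟨h, hx.2⟩)
        (measure_ne_top_of_subset inter_subset_left hAf) (by simp)
      have h3 : lm (Ioc α β) = β - α := by simp [lm, h]
      rwa [h3] at h2
    have hmono (α β : ℝ) (h : α ≤ β) : lm (A ∩ Iic α) ≤ lm (A ∩ Iic β) :=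
      lm_mono (inter_subset_inter_right _ (Iic_subset_Iic.2 h))
        (measure_ne_top_of_subset inter_subset_left hAf)
    refine (LipschitzWith.of_le_add fun α β => ?_).continuous
    rcases le_total α β with h | h
    · exact (hmono _ _ h).trans (le_add_of_nonneg_right dist_nonneg)
    · rw [Real.dist_eq, abs_of_nonneg (sub_nonneg.2 h)]
      exact hlip _ _ h
  have htop : Filter.Tendsto (fun α => lm (A ∩ Iic α)) Filter.atTop (nhds (lm A)) := by
    have h := (ENNReal.tendsto_toReal (measure_ne_top _ _)).comp
      (tendsto_measure_Iic_atTop (volume.restrict A))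
    simp only [Function.comp_def, hr, Measure.restrict_apply_univ] at h
    exact h
  have hbot : Filter.Tendsto (fun α => lm (A ∩ Iic α)) Filter.atBot (nhds 0) := by
    have h1 := tendsto_measure_iInter_atBot (μ := volume.restrict A)
      (s := fun α : ℝ => Iic α) (fun _ => measurableSet_Iic.nullMeasurableSet)
      (fun _ _ h => Iic_subset_Iic.2 h) ⟨0, measure_ne_top _ _⟩
    rw [iInter_Iic_eq_empty_iff.2 (by simp), measure_empty] at h1
    have h := (ENNReal.tendsto_toReal ENNReal.zero_ne_top).comp h1
    simp only [Function.comp_def, hr, ENNReal.toReal_zero] at h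
    exact h
  obtain ⟨x, hx⟩ := (hbot.eventually_lt_const h0).exists
  obtain ⟨y, hy⟩ := (htop.eventually_const_lt h1).exists
  exact mem_range_of_exists_le_of_exists_ge hcont ⟨x, hx.le⟩ ⟨y, hy.le⟩

/-- Truncating `A` from the left and `B` from the right by mass `σ` each lowers `1_A ∗ 1_B` by at
most `σ`. This pointwise bound integrates to the Kemperman–Pollard inequality on `ℝ`. -/
theorem cv_le_add_cv_truncate {A B : Set ℝ} (hA : MeasurableSet A) (hB : MeasurableSet B)
    (hAf : volume A ≠ ⊤) (hBf : volume B ≠ ⊤) {α β σ : ℝ} (hα : lm (A ∩ Iic α) ≤ σ)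
    (hβ : lm (B ∩ Ioi β) ≤ σ) (z : ℝ) :
    cv A B z ≤ σ + cv (A ∩ Ioi α) (B ∩ Iic β) z := by
  have hfin {s t : Set ℝ} (hs : volume s ≠ ⊤) : volume (s ∩ t) ≠ ⊤ :=
    measure_ne_top_of_subset inter_subset_left hs
  rw [cv_eq_lm hA hB, cv_eq_lm (hA.inter measurableSet_Ioi) (hB.inter measurableSet_Iic)]
  rcases le_or_gt (z - β) α with h | h
  · refine (lm_le_lm_add_lm (T := A ∩ Iic α) ?_ (hfin hAf) (hfin (hfin hAf))).trans
      (add_le_add_left hα _)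
    rintro x ⟨hx, hxB⟩
    rcases le_or_gt x α with hxα | hxα
    · exact Or.inl ⟨hx, hxα⟩
    · exact Or.inr ⟨⟨hx, hxα⟩, hxB, by simp only [mem_Iic]; linarith⟩
  · have hpre : volume ((fun y => z - y) ⁻¹' (B ∩ Ioi β)) = volume (B ∩ Ioi β) :=
      (Measure.measurePreserving_sub_left volume z).measure_preimage
        (hB.inter measurableSet_Ioi).nullMeasurableSet
    have hβ' : lm ((fun y => z - y) ⁻¹' (B ∩ Ioi β)) ≤ σ := by rwa [lm, hpre]
    refine (lm_le_lm_add_lm (T := (fun y => z - y) ⁻¹' (B ∩ Ioi β)) ?_ (hpre ▸ hfin hBf)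
      (hfin (hfin hAf))).trans (add_le_add_left hβ' _)
    rintro x ⟨hx, hxB⟩
    rcases le_or_gt (z - x) β with hxβ | hxβ
    · exact Or.inr ⟨⟨hx, by simp only [mem_Ioi]; linarith⟩, hxB, hxβ⟩
    · exact Or.inl ⟨hxB, hxβ⟩

theorem measurableSet_slev {A B : Set ℝ} (hA : MeasurableSet A) (hB : MeasurableSet B) (t : ℝ) :
    MeasurableSet (slev A B t) := by
  have h : StronglyMeasurable (cv A B) := by
    refine StronglyMeasurable.integral_prod_right
      (f := fun x y => A.indicator (1 : ℝ → ℝ) y * B.indicator (1 : ℝ → ℝ) (x - y)) ?_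
    have h1 : Measurable (A.indicator (1 : ℝ → ℝ)) := measurable_one.indicator hA
    have h2 : Measurable (B.indicator (1 : ℝ → ℝ)) := measurable_one.indicator hB
    exact ((h1.comp measurable_snd).mul
      (h2.comp (measurable_fst.sub measurable_snd))).stronglyMeasurable
  exact measurableSet_lt measurable_const h.measurable

theorem volume_slev_ne_top {A B : Set ℝ} (hA : MeasurableSet A) (hB : MeasurableSet B)
    (hAf : volume A ≠ ⊤) (hBf : volume B ≠ ⊤) {t : ℝ} (ht : 0 < t) :
    volume (slev A B t) ≠ ⊤ :=
  ((integrable_cv hA hB hAf hBf).measure_gt_lt_top ht).ne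

theorem integrable_cv_mul_indicator {A B E : Set ℝ} (hA : MeasurableSet A)
    (hB : MeasurableSet B) (hE : MeasurableSet E) (hAf : volume A ≠ ⊤) (hBf : volume B ≠ ⊤) :
    Integrable fun x => cv A B x * E.indicator (1 : ℝ → ℝ) x := by
  refine ((integrable_cv hA hB hAf hBf).indicator hE).congr (.of_forall fun x => ?_)
  by_cases hx : x ∈ E <;> simp [hx]

theorem pr_le_of_pos_of_lt {A B E : Set ℝ} (hA : MeasurableSet A) (hB : MeasurableSet B)
    (hE : MeasurableSet E) (hAf : volume A ≠ ⊤) (hBf : volume B ≠ ⊤) (hEf : volume E ≠ ⊤)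
    {σ τ : ℝ} (hσ : 0 < σ) (hσA : σ < lm A) (hσB : σ < lm B) (hτ : 0 < τ) :
    pr A B E ≤ σ * lm E + (lm A - σ) * (lm B - σ) + (σ - τ) * (lm (slev A B τ) - lm E) := by
  obtain ⟨α, hα⟩ := exists_lm_inter_Iic_eq hAf hσ hσA
  obtain ⟨β, hβ⟩ := exists_lm_inter_Iic_eq hBf (sub_pos.2 hσB) (by linarith : lm B - σ < lm B)
  have hα' := lm_inter_Iic_add_lm_inter_Ioi hAf α
  have hβ' := lm_inter_Iic_add_lm_inter_Ioi hBf β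
  have hA1 := hA.inter (measurableSet_Ioi (a := α))
  have hB1 := hB.inter (measurableSet_Iic (a := β))
  have hA1f : volume (A ∩ Ioi α) ≠ ⊤ := measure_ne_top_of_subset inter_subset_left hAf
  have hB1f : volume (B ∩ Iic β) ≠ ⊤ := measure_ne_top_of_subset inter_subset_left hBf
  have hS := measurableSet_slev hA hB τ
  have hSf := volume_slev_ne_top hA hB hAf hBf hτ
  have iE := integrable_indicator_one hE hEf
  have iS := integrable_indicator_one hS hSf
  have ig := integrable_cv hA1 hB1 hA1f hB1f
  have i1 : Integrable fun x =>
      σ * E.indicator (1 : ℝ → ℝ) x + cv (A ∩ Ioi α) (B ∩ Iic β) x :=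
    (iE.const_mul σ).add ig
  have i2 : Integrable fun x =>
      (σ - τ) * ((slev A B τ).indicator (1 : ℝ → ℝ) x - E.indicator (1 : ℝ → ℝ) x) :=
    (iS.sub iE).const_mul (σ - τ)
  have key : pr A B E ≤ ∫ x, (σ * E.indicator (1 : ℝ → ℝ) x + cv (A ∩ Ioi α) (B ∩ Iic β) x) +
      (σ - τ) * ((slev A B τ).indicator (1 : ℝ → ℝ) x - E.indicator (1 : ℝ → ℝ) x) := by
    refine integral_mono (integrable_cv_mul_indicator hA hB hE hAf hBf) (i1.add i2) fun x => ?_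
    have h1 := cv_le_add_cv_truncate hA hB hAf hBf hα.le (by linarith : lm (B ∩ Ioi β) ≤ σ) x
    have h2 := cv_nonneg (A ∩ Ioi α) (B ∩ Iic β) x
    by_cases hxE : x ∈ E <;> by_cases hxS : x ∈ slev A B τ <;>
      simp only [hxE, hxS, indicator_of_mem, indicator_of_notMem, not_false_eq_true,
        Pi.one_apply] <;> simp only [slev, mem_ofPred_eq, gt_iff_lt, not_lt] at hxS <;> linarith
  rw [integral_add i1 i2, integral_add (iE.const_mul σ) ig, integral_const_mul,
    integral_const_mul, integral_sub iS iE, integral_cv hA1 hB1 hA1f hB1f,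
    integral_indicator_one_eq_lm hE, integral_indicator_one_eq_lm hS, hβ,
    show lm (A ∩ Ioi α) = lm A - σ by linarith] at key
  exact key

theorem measurableSet_sstar (S : Set ℝ) : MeasurableSet (sstar S) := measurableSet_Ioo

theorem volume_sstar_ne_top (S : Set ℝ) : volume (sstar S) ≠ ⊤ := by simp [sstar]

theorem lm_sstar (S : Set ℝ) : lm (sstar S) = lm S := by
  have := lm_nonneg S
  simp [sstar, lm] at *

theorem cv_sstar_le (A B : Set ℝ) (x : ℝ) :
    cv (sstar A) (sstar B) x ≤ max 0 ((lm A + lm B) / 2 - |x|) := by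
  rw [cv_eq_lm (measurableSet_sstar A) (measurableSet_sstar B)]
  have hI (u v : ℝ) : lm (Ioo u v) = max 0 (v - u) := by
    rw [lm, Real.volume_Ioo, ENNReal.toReal_ofReal', max_comm]
  rcases le_total 0 x with h | h
  · refine (lm_mono (T := Ioo (x - lm B / 2) (lm A / 2)) ?_ (by simp)).trans ?_
    · rintro y ⟨⟨h1, h2⟩, h3, h4⟩
      exact ⟨by linarith, h2⟩
    · rw [hI, abs_of_nonneg h]
      exact max_le_max le_rfl (by linarith)
  · refine (lm_mono (T := Ioo (-(lm A / 2)) (x + lm B / 2)) ?_ (by simp)).trans ?_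
    · rintro y ⟨⟨h1, h2⟩, h3, h4⟩
      exact ⟨h1, by linarith⟩
    · rw [hI, abs_of_nonpos h]
      exact max_le_max le_rfl (by linarith)

theorem le_pr_sstar (A B E : Set ℝ) (h : lm E ≤ lm A + lm B) :
    lm A * lm B - ((lm A + lm B - lm E) / 2) ^ 2 ≤ pr (sstar A) (sstar B) (sstar E) := by
  set c := (lm A + lm B) / 2 with hc
  set e := lm E / 2 with he
  have hec : e ≤ c := by linarith
  have he0 : 0 ≤ e := by linarith [lm_nonneg E]
  have i0 := integrable_cv_mul_indicator (measurableSet_sstar A) (measurableSet_sstar B)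
    (measurableSet_sstar E) (volume_sstar_ne_top A) (volume_sstar_ne_top B)
  have i1 : Integrable ((Icc e c).indicator fun x => c - x) :=
    (integrable_indicator_iff measurableSet_Icc).2
      (Continuous.integrableOn_Icc (by fun_prop))
  have i2 : Integrable ((Icc (-c) (-e)).indicator fun x => c + x) :=
    (integrable_indicator_iff measurableSet_Icc).2
      (Continuous.integrableOn_Icc (by fun_prop))
  have i12 : Integrable fun x =>
      (Icc e c).indicator (fun x => c - x) x + (Icc (-c) (-e)).indicator (fun x => c + x) x :=
    i1.add i2
  have v1 : ∫ x, (Icc e c).indicator (fun x => c - x) x = (c - e) ^ 2 / 2 := by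
    rw [integral_indicator measurableSet_Icc, integral_Icc_eq_integral_Ioc,
      ← intervalIntegral.integral_of_le hec, intervalIntegral.integral_sub (by simp) (by simp)]
    simp only [intervalIntegral.integral_const, integral_id, smul_eq_mul]
    ring
  have v2 : ∫ x, (Icc (-c) (-e)).indicator (fun x => c + x) x = (c - e) ^ 2 / 2 := by
    rw [integral_indicator measurableSet_Icc, integral_Icc_eq_integral_Ioc,
      ← intervalIntegral.integral_of_le (neg_le_neg hec),
      intervalIntegral.integral_add (by simp) (by simp)]
    simp only [intervalIntegral.integral_const, integral_id, smul_eq_mul]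
    ring
  have key : ∫ x, cv (sstar A) (sstar B) x ≤
      ∫ x, cv (sstar A) (sstar B) x * (sstar E).indicator (1 : ℝ → ℝ) x +
        ((Icc e c).indicator (fun x => c - x) x + (Icc (-c) (-e)).indicator (fun x => c + x) x) := by
    refine integral_mono (integrable_cv (measurableSet_sstar A) (measurableSet_sstar B)
      (volume_sstar_ne_top A) (volume_sstar_ne_top B)) (i0.add i12) fun x => ?_
    have n1 : 0 ≤ (Icc e c).indicator (fun x => c - x) x :=
      indicator_nonneg (fun y hy => sub_nonneg.2 hy.2) x
    have n2 : 0 ≤ (Icc (-c) (-e)).indicator (fun x => c + x) x :=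
      indicator_nonneg (fun y hy => by linarith [hy.1]) x
    have hle := cv_sstar_le A B x
    rw [← hc] at hle
    dsimp only
    by_cases hx : x ∈ sstar E
    · rw [indicator_of_mem hx, Pi.one_apply, mul_one]
      linarith
    rw [indicator_of_notMem hx, mul_zero, zero_add]
    refine hle.trans (max_le (add_nonneg n1 n2) ?_)
    have hx' : e ≤ |x| := not_lt.1 fun h => hx (abs_lt.1 h)
    rcases le_or_gt |x| c with hxc | hxc
    · rcases le_total 0 x with h0 | h0
      · rw [abs_of_nonneg h0] at *
        rw [indicator_of_mem (show x ∈ Icc e c from ⟨hx', hxc⟩)]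
        linarith
      · rw [abs_of_nonpos h0] at *
        rw [indicator_of_mem (show x ∈ Icc (-c) (-e) from ⟨by linarith, by linarith⟩)]
        linarith
    · linarith
  rw [integral_add i0 i12, integral_add i1 i2, v1, v2,
    integral_cv (measurableSet_sstar A) (measurableSet_sstar B)
      (volume_sstar_ne_top A) (volume_sstar_ne_top B), lm_sstar, lm_sstar] at key
  have hce : (lm A + lm B - lm E) / 2 = c - e := by rw [hc, he]; ring
  rw [hce, pr]
  linarith

/-- Refinement of the Riesz–Sobolev inequality on ℝ. -/
theorem riesz_sobolev_refined (A B E : Set ℝ)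
    (hA : MeasurableSet A) (hB : MeasurableSet B) (hE : MeasurableSet E)
    (hA0 : 0 < volume A) (hAf : volume A ≠ ⊤)
    (hB0 : 0 < volume B) (hBf : volume B ≠ ⊤)
    (hE0 : 0 < volume E) (hEf : volume E ≠ ⊤)
    (hlo : |lm A - lm B| + 2 * Real.sqrt (rsD A B E) < lm E)
    (hhi : lm E < lm A + lm B - 2 * Real.sqrt (rsD A B E))
    (τE : ℝ) (hτ : lm E = lm A + lm B - 2*τE) :
    pr A B E + (1/16) * (lm (slev A B τE) - (lm A + lm B - 2*τE))^2
      ≤ pr (sstar A) (sstar B) (sstar E) := by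
  have hD0 := Real.sqrt_nonneg (rsD A B E)
  obtain ⟨hab, hba⟩ := abs_le.1 (le_refl |lm A - lm B|)
  have hA1 : τE + √(rsD A B E) < lm A := by linarith
  have hB1 : τE + √(rsD A B E) < lm B := by linarith
  have hstar := le_pr_sstar A B E (by linarith)
  rw [show (lm A + lm B - lm E) / 2 = τE by linarith] at hstar
  obtain ⟨r, hr, hr'⟩ := exists_between
    (lt_min (by linarith : √(rsD A B E) < τE)
      (lt_min (by linarith : √(rsD A B E) < lm A - τE)
        (by linarith : √(rsD A B E) < lm B - τE)))
  obtain ⟨hr1, hr2, hr3⟩ : r < τE ∧ r < lm A - τE ∧ r < lm B - τE := by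
    simpa only [lt_min_iff] using hr'
  have hDr : rsD A B E < r ^ 2 := (Real.sqrt_lt' (by linarith)).1 hr
  rw [rsD] at hDr
  rw [← hτ]
  set k := lm (slev A B τE) - lm E with hk
  have key (h : ℝ) (h1 : -r ≤ h) (h2 : h ≤ r) :
      pr A B E ≤ lm A * lm B - τE ^ 2 + h ^ 2 + h * k := by
    have := pr_le_of_pos_of_lt hA hB hE hAf hBf hEf (σ := τE + h) (τ := τE)
      (by linarith) (by linarith) (by linarith) (by linarith)
    rw [← hk, hτ] at this
    linarith
  have hr0 : 0 < r := by linarith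
  rcases le_or_gt |k| (2 * r) with hkr | hkr
  · have hk' := abs_le.1 hkr
    have := key (-k / 2) (by linarith) (by linarith)
    nlinarith [sq_nonneg k]
  · rcases lt_abs.1 hkr with h | h
    · have := key (-r) le_rfl (by linarith)
      nlinarith
    · have := key r (by linarith) le_rfl
      nlinarith
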